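/- arXiv:0712.1183 — 4 statements merged into one kernel-verified Lean document; each statement's English description precedes it below -/
import Mathlib

section
/- Let λ be a nonnegative integer and let a ∈ ℂ. The complex vector space of holomorphic functions ψ : ℂ∖{0} → ℂ satisfying ψ''(t) = (λ(λ+1)·t⁻² + a²·t⁻¹)·ψ(t) for all t ∈ ℂ∖{0} has dimension 2 if and only if a = 0. -/
/-- The space of global holomorphic solutions on `ℂ ∖ {0}` of the equation
`ψ''(t) = (λ(λ+1)·t⁻² + a²·t⁻¹)·ψ(t)`, modelled as functions `ℂ → ℂ` vanishing at `0`
(a function on the punctured plane being identified with its extension by zero),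
holomorphic at every `t ≠ 0` and satisfying the equation there. -/
def slTwoOperSolutionSet (lam : ℕ) (a : ℂ) : Set (ℂ → ℂ) :=
  {ψ | ψ 0 = 0 ∧ (∀ t : ℂ, t ≠ 0 → DifferentiableAt ℂ ψ t) ∧
    (∀ t : ℂ, t ≠ 0 → DifferentiableAt ℂ (deriv ψ) t) ∧
    ∀ t : ℂ, t ≠ 0 →
      deriv (deriv ψ) t = ((lam : ℂ) * ((lam : ℂ) + 1) * (t⁻¹) ^ 2 + a ^ 2 * t⁻¹) * ψ t}

open Metric

/-- A continuous function on a circle all of whose Laurent moments vanish is zero there. -/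
theorem eqOn_sphere_zero_of_circleIntegral_zpow_mul_eq_zero {ψ : ℂ → ℂ} {R : ℝ} (hR : 0 < R)
    (hψ : ContinuousOn ψ (sphere 0 R)) (h : ∀ k : ℤ, (∮ z in C(0, R), z ^ k * ψ z) = 0) :
    ∀ z ∈ sphere (0 : ℂ) R, ψ z = 0 := by
  have : Fact (0 < 2 * Real.pi) := ⟨Real.two_pi_pos⟩
  have hRc : (R : ℂ) ≠ 0 := by exact_mod_cast hR.ne'
  let f : C(AddCircle (2 * Real.pi), ℂ) :=
    ⟨fun x => ψ (R * (AddCircle.toCircle x : ℂ)), hψ.comp_continuous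
      (continuous_const.mul (continuous_subtype_val.comp AddCircle.continuous_toCircle))
      fun x => by
        rw [mem_sphere_zero_iff_norm, norm_mul, Circle.norm_coe, mul_one, Complex.norm_real,
          Real.norm_of_nonneg hR.le]⟩
  have hf : ∀ θ : ℝ, f (θ : AddCircle (2 * Real.pi)) = ψ (circleMap 0 R θ) := fun θ => by
    simp [f, AddCircle.toCircle_apply_mk, circleMap, Real.pi_ne_zero]
  have hcoeff : fourierCoeff f = 0 := by
    funext n
    rw [fourierCoeff_eq_intervalIntegral _ _ 0, zero_add]
    have hpt : ∀ θ : ℝ, fourier (-n) (θ : AddCircle (2 * Real.pi)) • f θ =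
        (R : ℂ) ^ n * -Complex.I *
          (deriv (circleMap 0 R) θ • (circleMap 0 R θ ^ (-n - 1) * ψ (circleMap 0 R θ))) := by
      intro θ
      have hc : circleMap 0 R θ ≠ 0 := circleMap_ne_center hR.ne'
      have hpow : (circleMap 0 R θ) ^ n = (R : ℂ) ^ n * Complex.exp (n * (θ * Complex.I)) := by
        rw [Complex.exp_int_mul, ← mul_zpow]
        simp [circleMap]
      have hexp : 2 * (Real.pi : ℂ) * Complex.I * ((-n : ℤ) : ℂ) * θ / ((2 * Real.pi : ℝ) : ℂ) =
          -(n * (θ * Complex.I)) := by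
        have : (Real.pi : ℂ) ≠ 0 := by exact_mod_cast Real.pi_ne_zero
        push_cast
        field_simp
      rw [hf, fourier_coe_apply, hexp, Complex.exp_neg, deriv_circleMap, zpow_sub_one₀ hc, zpow_neg,
        hpow, smul_eq_mul, smul_eq_mul]
      field_simp
      simp
    simp_rw [hpt]
    rw [intervalIntegral.integral_const_mul]
    have := h (-n - 1)
    rw [circleIntegral] at this
    rw [this, mul_zero, smul_zero, Pi.zero_apply]
  intro z hz
  rw [← abs_of_pos hR, ← range_circleMap] at hz
  obtain ⟨θ, rfl⟩ := hz
  have hsum := has_pointwise_sum_fourier_series_of_summable (f := f)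
    (by rw [hcoeff]; exact summable_zero) (θ : AddCircle (2 * Real.pi))
  rw [hcoeff, hf] at hsum
  exact hsum.unique (by simp)

/-- Laurent moments of a function holomorphic on the punctured plane do not depend on the
radius. -/
theorem circleIntegral_eq_of_differentiableAt_ne_zero {f : ℂ → ℂ}
    (hf : ∀ t : ℂ, t ≠ 0 → DifferentiableAt ℂ f t) {r R : ℝ} (hr : 0 < r) (hR : 0 < R) :
    (∮ z in C(0, R), f z) = ∮ z in C(0, r), f z := by
  wlog hle : r ≤ R generalizing r R
  · exact (this hR hr (le_of_not_ge hle)).symm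
  refine Complex.circleIntegral_eq_of_differentiable_on_annulus_off_countable hr hle
    Set.countable_empty (fun z hz => (hf z ?_).continuousAt.continuousWithinAt)
    fun z hz => hf z ?_
  · rintro rfl
    exact hz.2 (mem_ball_self hr)
  · rintro rfl
    exact hz.1.2 (mem_closedBall_self hr.le)

theorem differentiableAt_zpow_mul {f : ℂ → ℂ} (hf : ∀ t : ℂ, t ≠ 0 → DifferentiableAt ℂ f t)
    (k : ℤ) (t : ℂ) (ht : t ≠ 0) : DifferentiableAt ℂ (fun z => z ^ k * f z) t :=
  (differentiableAt_zpow.2 (Or.inl ht)).mul (hf t ht)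

theorem circleIntegrable_of_differentiableAt_ne_zero {f : ℂ → ℂ}
    (hf : ∀ t : ℂ, t ≠ 0 → DifferentiableAt ℂ f t) : CircleIntegrable f 0 1 :=
  ContinuousOn.circleIntegrable zero_le_one fun z hz =>
    (hf z (ne_of_mem_sphere hz one_ne_zero)).continuousAt.continuousWithinAt

/-- A function holomorphic on the punctured plane all of whose Laurent moments vanish is zero. -/
theorem eq_zero_of_circleIntegral_zpow_mul_eq_zero {ψ : ℂ → ℂ}
    (hψ : ∀ t : ℂ, t ≠ 0 → DifferentiableAt ℂ ψ t)
    (h : ∀ k : ℤ, (∮ z in C(0, 1), z ^ k * ψ z) = 0) {t : ℂ} (ht : t ≠ 0) : ψ t = 0 := by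
  have hR : 0 < ‖t‖ := norm_pos_iff.2 ht
  refine eqOn_sphere_zero_of_circleIntegral_zpow_mul_eq_zero hR
    (fun z hz => (hψ z (ne_of_mem_sphere hz hR.ne')).continuousAt.continuousWithinAt)
    (fun k => ?_) t (by simp)
  rw [circleIntegral_eq_of_differentiableAt_ne_zero (differentiableAt_zpow_mul hψ k) one_pos hR, h]

/-- The global solutions of the equation, as a subspace of `ℂ → ℂ`. -/
def slTwoOperSolutionSpace (lam : ℕ) (a : ℂ) : Submodule ℂ (ℂ → ℂ) where
  carrier := slTwoOperSolutionSet lam a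
  zero_mem' := by
    have h : deriv (0 : ℂ → ℂ) = 0 := by
      funext t
      exact deriv_const t 0
    refine ⟨rfl, fun t _ => differentiableAt_const _, fun t _ => ?_, fun t _ => ?_⟩
    · rw [h]
      exact differentiableAt_const _
    · simp [h]
  add_mem' := by
    rintro φ ψ ⟨hφ0, hφ1, hφ2, hφ3⟩ ⟨hψ0, hψ1, hψ2, hψ3⟩
    have h : ∀ t : ℂ, t ≠ 0 → deriv (φ + ψ) =ᶠ[nhds t] deriv φ + deriv ψ := fun t ht => by
      filter_upwards [isOpen_ne.mem_nhds ht] with s hs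
      exact deriv_add (hφ1 s hs) (hψ1 s hs)
    refine ⟨by simp [hφ0, hψ0], fun t ht => (hφ1 t ht).add (hψ1 t ht), fun t ht => ?_,
      fun t ht => ?_⟩
    · exact ((hφ2 t ht).add (hψ2 t ht)).congr_of_eventuallyEq (h t ht)
    · rw [(h t ht).deriv_eq, deriv_add (hφ2 t ht) (hψ2 t ht), hφ3 t ht, hψ3 t ht, Pi.add_apply]
      ring
  smul_mem' := by
    rintro c ψ ⟨hψ0, hψ1, hψ2, hψ3⟩
    have h : ∀ t : ℂ, t ≠ 0 → deriv (c • ψ) =ᶠ[nhds t] c • deriv ψ := fun t ht => by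
      filter_upwards [isOpen_ne.mem_nhds ht] with s hs
      exact deriv_const_smul c (hψ1 s hs)
    refine ⟨by simp [hψ0], fun t ht => (hψ1 t ht).const_smul c, fun t ht => ?_, fun t ht => ?_⟩
    · exact ((hψ2 t ht).const_smul c).congr_of_eventuallyEq (h t ht)
    · rw [(h t ht).deriv_eq, deriv_const_smul c (hψ2 t ht), hψ3 t ht, Pi.smul_apply,
        smul_eq_mul, smul_eq_mul]
      ring

/-- The Laurent moment `∮ z ^ k * ψ z` of a global solution. -/
noncomputable def laurentMoment (lam : ℕ) (a : ℂ) (k : ℤ) :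
    slTwoOperSolutionSpace lam a →ₗ[ℂ] ℂ where
  toFun ψ := ∮ z in C(0, 1), z ^ k * ψ.1 z
  map_add' φ ψ := by
    rw [← circleIntegral.integral_add
      (circleIntegrable_of_differentiableAt_ne_zero (differentiableAt_zpow_mul φ.2.2.1 k))
      (circleIntegrable_of_differentiableAt_ne_zero (differentiableAt_zpow_mul ψ.2.2.1 k))]
    simp only [Submodule.coe_add, Pi.add_apply, mul_add]
  map_smul' c ψ := by
    simp [← circleIntegral.integral_const_mul, mul_left_comm]

theorem eq_zero_of_laurentMoment_eq_zero {lam : ℕ} {a : ℂ} (ψ : slTwoOperSolutionSpace lam a)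
    (h : ∀ k, laurentMoment lam a k ψ = 0) : ψ = 0 := by
  ext t
  rcases eq_or_ne t 0 with rfl | ht
  · exact ψ.2.1
  · exact eq_zero_of_circleIntegral_zpow_mul_eq_zero ψ.2.2.1 h ht

/-- The differential equation as a recurrence between Laurent moments. -/
theorem laurentMoment_recurrence {lam : ℕ} {a : ℂ} (ψ : slTwoOperSolutionSpace lam a) (k : ℤ) :
    a ^ 2 * laurentMoment lam a (k - 1) ψ =
      ((k : ℂ) - lam - 1) * (k + lam) * laurentMoment lam a (k - 2) ψ := by
  obtain ⟨ψ, -, h1, h2, h3⟩ := ψ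
  change a ^ 2 * (∮ z in C(0, 1), z ^ (k - 1) * ψ z) =
    ((k : ℂ) - lam - 1) * (k + lam) * ∮ z in C(0, 1), z ^ (k - 2) * ψ z
  have hne : ∀ z ∈ sphere (0 : ℂ) 1, z ≠ 0 := fun z hz => ne_of_mem_sphere hz one_ne_zero
  rw [← sub_eq_zero, ← circleIntegral.integral_const_mul, ← circleIntegral.integral_const_mul,
    ← circleIntegral.integral_sub
      (circleIntegrable_of_differentiableAt_ne_zero fun t ht =>
        (differentiableAt_zpow_mul h1 _ t ht).const_mul _)
      (circleIntegrable_of_differentiableAt_ne_zero fun t ht =>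
        (differentiableAt_zpow_mul h1 _ t ht).const_mul _)]
  refine circleIntegral.integral_eq_zero_of_hasDerivWithinAt
    (f := fun z => z ^ k * deriv ψ z - k * (z ^ (k - 1) * ψ z)) zero_le_one fun z hz => ?_
  have hz := hne z hz
  have hd := ((hasDerivAt_zpow k z (Or.inl hz)).mul (h2 z hz).hasDerivAt).sub
    (((hasDerivAt_zpow (k - 1) z (Or.inl hz)).mul (h1 z hz).hasDerivAt).const_mul (k : ℂ))
  refine (hd.congr_deriv ?_).hasDerivWithinAt
  rw [h3 z hz, show k - 1 - 1 = k - 2 by ring, show k - 1 = k - 2 + 1 by ring, zpow_add_one₀ hz,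
    show z ^ k = z ^ (k - 2) * z * z by
      rw [← zpow_add_one₀ hz, ← zpow_add_one₀ hz]; congr 1; ring]
  field_simp
  push_cast
  ring

/-- For `a ≠ 0` a global solution is determined by its Laurent coefficient of order `λ + 1`. -/
theorem laurentMoment_injective {lam : ℕ} {a : ℂ} (ha : a ≠ 0) :
    Function.Injective (laurentMoment lam a (-lam - 2)) := by
  rw [← LinearMap.ker_eq_bot, LinearMap.ker_eq_bot']
  intro ψ hψ
  have hup : ∀ n : ℕ, laurentMoment lam a (-lam - 1 + n) ψ = 0 := by
    intro n
    have hrec := laurentMoment_recurrence ψ (-lam + n)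
    induction n with
    | zero => simpa [ha] using hrec
    | succ n ih =>
      have := ih (laurentMoment_recurrence ψ (-lam + n))
      rw [show (-lam + (n + 1 : ℕ) - 2 : ℤ) = -lam - 1 + n by push_cast; ring, this, mul_zero,
        show (-lam + (n + 1 : ℕ) - 1 : ℤ) = -lam - 1 + (n + 1 : ℕ) by push_cast; ring] at hrec
      simpa [ha] using hrec
  have hdown : ∀ n : ℕ, laurentMoment lam a (-lam - 2 - n) ψ = 0 := by
    intro n
    induction n with
    | zero => simpa using hψ
    | succ n ih =>
      have hrec := laurentMoment_recurrence ψ (-lam - (n + 1 : ℕ))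
      rw [show (-lam - (n + 1 : ℕ) - 1 : ℤ) = -lam - 2 - n by push_cast; ring, ih, mul_zero,
        show (-lam - (n + 1 : ℕ) - 2 : ℤ) = -lam - 2 - (n + 1 : ℕ) by ring] at hrec
      refine (mul_eq_zero.1 hrec.symm).resolve_left (mul_ne_zero ?_ ?_)
      · exact_mod_cast (by omega : (-lam - (n + 1 : ℕ) - lam - 1 : ℤ) ≠ 0)
      · exact_mod_cast (by omega : (-lam - (n + 1 : ℕ) + lam : ℤ) ≠ 0)
  refine eq_zero_of_laurentMoment_eq_zero ψ fun k => ?_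
  rcases le_or_gt (-lam - 1 : ℤ) k with hk | hk
  · obtain ⟨n, rfl⟩ := Int.le.dest hk
    exact hup n
  · obtain ⟨n, hn⟩ := Int.le.dest (show k ≤ -lam - 2 by omega)
    rw [show k = -lam - 2 - n by omega]
    exact hdown n

/-- For `a = 0` a global solution is determined by its Laurent coefficients of orders `λ + 1`
and `-λ`. -/
theorem laurentMoment_prod_injective (lam : ℕ) :
    Function.Injective
      ((laurentMoment lam 0 (-lam - 2)).prod (laurentMoment lam 0 (lam - 1))) := by
  rw [← LinearMap.ker_eq_bot, LinearMap.ker_eq_bot']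
  intro ψ hψ
  obtain ⟨hneg, hpos⟩ := Prod.mk.inj hψ
  refine eq_zero_of_laurentMoment_eq_zero ψ fun k => ?_
  by_cases h1 : k = -lam - 2
  · rw [h1]; exact hneg
  by_cases h2 : k = lam - 1
  · rw [h2]; exact hpos
  have hrec := laurentMoment_recurrence ψ (k + 2)
  rw [zero_pow two_ne_zero, zero_mul, add_sub_cancel_right] at hrec
  refine (mul_eq_zero.1 hrec.symm).resolve_left (mul_ne_zero ?_ ?_)
  · exact_mod_cast (by omega : (k + 2 - lam - 1 : ℤ) ≠ 0)
  · exact_mod_cast (by omega : (k + 2 + lam : ℤ) ≠ 0)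

/-- The integer power `t ^ m` on the punctured plane, extended by zero. -/
noncomputable def puncturedZpow (m : ℤ) (t : ℂ) : ℂ := if t = 0 then 0 else t ^ m

theorem puncturedZpow_of_ne_zero (m : ℤ) {t : ℂ} (ht : t ≠ 0) : puncturedZpow m t = t ^ m :=
  if_neg ht

theorem hasDerivAt_puncturedZpow (m : ℤ) {t : ℂ} (ht : t ≠ 0) :
    HasDerivAt (puncturedZpow m) (m * t ^ (m - 1)) t := by
  refine (hasDerivAt_zpow m t (Or.inl ht)).congr_of_eventuallyEq ?_
  filter_upwards [isOpen_ne.mem_nhds ht] with s hs using puncturedZpow_of_ne_zero m hs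

theorem puncturedZpow_mem (lam : ℕ) (m : ℤ) (hm : m * (m - 1) = lam * (lam + 1)) :
    puncturedZpow m ∈ slTwoOperSolutionSpace lam 0 := by
  have hd : ∀ t : ℂ, t ≠ 0 →
      HasDerivAt (deriv (puncturedZpow m)) (m * ((m - 1 : ℤ) * t ^ (m - 1 - 1))) t := by
    intro t ht
    refine ((hasDerivAt_zpow (m - 1) t (Or.inl ht)).const_mul (m : ℂ)).congr_of_eventuallyEq ?_
    filter_upwards [isOpen_ne.mem_nhds ht] with s hs using (hasDerivAt_puncturedZpow m hs).deriv
  refine ⟨if_pos rfl, fun t ht => (hasDerivAt_puncturedZpow m ht).differentiableAt,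
    fun t ht => (hd t ht).differentiableAt, fun t ht => ?_⟩
  rw [(hd t ht).deriv, puncturedZpow_of_ne_zero m ht, ← mul_assoc, zpow_sub_one₀ ht,
    zpow_sub_one₀ ht]
  have hmc : (m : ℂ) * ((m - 1 : ℤ) : ℂ) = lam * (lam + 1) := by exact_mod_cast hm
  rw [hmc]
  ring

theorem linearIndependent_puncturedZpow {m n : ℤ} (hmn : m ≠ n) :
    LinearIndependent ℂ ![puncturedZpow m, puncturedZpow n] := by
  rw [LinearIndependent.pair_iff]
  intro s t h
  have h1 := congrFun h 1
  have h2 := congrFun h 2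
  simp only [Pi.add_apply, Pi.smul_apply, Pi.zero_apply, smul_eq_mul,
    puncturedZpow_of_ne_zero _ one_ne_zero, puncturedZpow_of_ne_zero _ two_ne_zero,
    one_zpow, mul_one] at h1 h2
  have hne : (2 : ℂ) ^ m - 2 ^ n ≠ 0 := by
    rw [sub_ne_zero]
    intro h
    have h' : (2 : ℝ) ^ m = 2 ^ n := by simpa using congrArg norm h
    exact hmn (zpow_right_injective₀ two_pos (by norm_num) h')
  have hs : s = 0 := by
    refine (mul_eq_zero.1 (?_ : s * ((2 : ℂ) ^ m - 2 ^ n) = 0)).resolve_right hne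
    linear_combination h2 - 2 ^ n * h1
  exact ⟨hs, by simpa [hs] using h1⟩

theorem finrank_slTwoOperSolutionSpace_zero (lam : ℕ) :
    Module.finrank ℂ (slTwoOperSolutionSpace lam 0) = 2 := by
  have hinj := laurentMoment_prod_injective lam
  have : FiniteDimensional ℂ (slTwoOperSolutionSpace lam 0) := FiniteDimensional.of_injective _ hinj
  refine le_antisymm ?_ ?_
  · simpa using LinearMap.finrank_le_finrank_of_injective hinj
  · have hli : LinearIndependent ℂ
        (![⟨puncturedZpow (lam + 1), puncturedZpow_mem lam _ (by ring)⟩,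
          ⟨puncturedZpow (-lam), puncturedZpow_mem lam _ (by ring)⟩] :
            Fin 2 → slTwoOperSolutionSpace lam 0) := by
      refine LinearIndependent.of_comp (Submodule.subtype _) ?_
      convert linearIndependent_puncturedZpow (show (lam + 1 : ℤ) ≠ -lam by omega) using 1
      funext i
      fin_cases i <;> rfl
    simpa using hli.fintype_card_le_finrank

/-- For `λ ∈ ℕ` and `a ∈ ℂ`, the space of holomorphic solutions on `ℂ ∖ {0}` of
`ψ'' = (λ(λ+1)t⁻² + a²t⁻¹)ψ` has complex dimension 2 if and only if `a = 0`. -/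
theorem dim_solution_space_eq_two_iff (lam : ℕ) (a : ℂ) :
    Module.finrank ℂ ↥(Submodule.span ℂ (slTwoOperSolutionSet lam a)) = 2 ↔ a = 0 := by
  rw [show Submodule.span ℂ (slTwoOperSolutionSet lam a) = slTwoOperSolutionSpace lam a from
    Submodule.span_eq (slTwoOperSolutionSpace lam a)]
  refine ⟨fun h => ?_, ?_⟩
  · by_contra ha
    have := LinearMap.finrank_le_finrank_of_injective (laurentMoment_injective (lam := lam) ha)
    rw [h, Module.finrank_self] at this
    omega
  · rintro rfl
    exact finrank_slTwoOperSolutionSpace_zero lam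
end

section
/- Let λ be a nonnegative integer and a ∈ ℂ, and let A(t) be the 2×2 complex matrix with entries A₂₁(t) = 1, A₁₂(t) = λ(λ+1)t⁻² + a²t⁻¹, A₁₁(t) = A₂₂(t) = 0. Then there exists a holomorphic map Φ : ℂ∖{0} → GL₂(ℂ) satisfying Φ'(t) = −A(t)·Φ(t) for all t ∈ ℂ∖{0} if and only if a = 0. -/
open Matrix

/-- The connection matrix `A(t)` of the sl₂-oper: `A₁₁ = A₂₂ = 0`, `A₁₂ = λ(λ+1)t⁻² + a²t⁻¹`,
`A₂₁ = 1`. -/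
noncomputable def operConnMatrix (lam : ℕ) (a : ℂ) (t : ℂ) : Matrix (Fin 2) (Fin 2) ℂ :=
  !![0, (lam : ℂ) * ((lam : ℂ) + 1) * (t⁻¹) ^ 2 + a ^ 2 * t⁻¹; 1, 0]

theorem circleIntegrable_const_mul {f : ℂ → ℂ} {c : ℂ} {R : ℝ} (hf : CircleIntegrable f c R)
    (b : ℂ) : CircleIntegrable (fun z => b * f z) c R :=
  IntervalIntegrable.const_mul hf b

/-- A continuous function on the unit circle all of whose moments `∮ v(z) zⁿ dz` vanish is zero. -/
theorem eq_zero_of_circleIntegral_mul_zpow_eq_zero {v : ℂ → ℂ}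
    (hv : ContinuousOn v (Metric.sphere 0 1))
    (hm : ∀ n : ℤ, (∮ z in C(0, 1), v z * z ^ n) = 0) {z : ℂ} (hz : ‖z‖ = 1) : v z = 0 := by
  have : Fact (0 < 2 * Real.pi) := ⟨Real.two_pi_pos⟩
  have hcont : Continuous fun x : AddCircle (2 * Real.pi) => v (AddCircle.toCircle x : ℂ) :=
    hv.comp_continuous (continuous_subtype_val.comp AddCircle.continuous_toCircle)
      fun x => by simp [Circle.norm_coe]
  have hcoe : ∀ θ : ℝ, ((AddCircle.toCircle (θ : AddCircle (2 * Real.pi)) : Circle) : ℂ)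
      = circleMap 0 1 θ := fun θ => by
    rw [AddCircle.toCircle_apply_mk, Circle.coe_exp, circleMap]
    simp [Real.pi_ne_zero]
  let f : C(AddCircle (2 * Real.pi), ℂ) := ⟨_, hcont⟩
  have hcoeff : fourierCoeff f = 0 := by
    funext n
    rw [fourierCoeff_eq_intervalIntegral f n 0, zero_add, Pi.zero_apply]
    have h := hm (-n - 1)
    rw [circleIntegral] at h
    have hI : (∫ θ in (0 : ℝ)..2 * Real.pi,
        fourier (-n) (θ : AddCircle (2 * Real.pi)) • f θ) * Complex.I = 0 := by
      rw [← h, ← intervalIntegral.integral_mul_const]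
      refine intervalIntegral.integral_congr fun θ _ => ?_
      have h0 : circleMap 0 1 θ ≠ 0 := circleMap_ne_center one_ne_zero
      have hf : f θ = v (circleMap 0 1 θ) := congrArg v (hcoe θ)
      simp only [fourier_apply, AddCircle.toCircle_zsmul, Circle.coe_zpow, hcoe, hf, smul_eq_mul,
        deriv_circleMap]
      rw [zpow_sub_one₀ h0]
      field_simp
    rw [(mul_eq_zero.mp hI).resolve_right Complex.I_ne_zero, smul_zero]
  have hsum := has_pointwise_sum_fourier_series_of_summable (f := f)
    (by rw [hcoeff]; exact summable_zero) (Complex.arg z : AddCircle (2 * Real.pi))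
  simp only [hcoeff, Pi.zero_apply, zero_smul] at hsum
  have hfz : f (Complex.arg z : AddCircle (2 * Real.pi)) = v z := by
    refine congrArg v ((hcoe _).trans ?_)
    have := Complex.norm_mul_exp_arg_mul_I z
    rw [hz] at this
    rw [circleMap, zero_add, this]
  rw [← hfz]
  exact hsum.unique hasSum_zero

section Moments

variable {lam : ℕ} {a : ℂ} {u v : ℂ → ℂ}

/-- Moments of a single-valued solution of the oper system satisfy a two-term recurrence. -/
theorem oper_moment_recurrence
    (hu : ∀ t : ℂ, t ≠ 0 →
      HasDerivAt u (-((lam : ℂ) * (lam + 1) * (t⁻¹) ^ 2 + a ^ 2 * t⁻¹) * v t) t)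
    (hv : ∀ t : ℂ, t ≠ 0 → HasDerivAt v (-u t) t) (k : ℤ) :
    ((k : ℂ) - lam + 1) * (k + lam + 2) * (∮ z in C(0, 1), v z * z ^ k) =
      a ^ 2 * ∮ z in C(0, 1), v z * z ^ (k + 1) := by
  have hne : ∀ z ∈ Metric.sphere (0 : ℂ) 1, z ≠ 0 := fun z hz =>
    ne_zero_of_mem_unit_sphere ⟨z, hz⟩
  have hint : ∀ {w : ℂ → ℂ}, (∀ t : ℂ, t ≠ 0 → ContinuousAt w t) → ∀ n : ℤ,
      CircleIntegrable (fun z => w z * z ^ n) 0 1 := fun hw n =>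
    ContinuousOn.circleIntegrable zero_le_one fun z hz =>
      ((hw z (hne z hz)).mul (continuousAt_zpow₀ z n (Or.inl (hne z hz)))).continuousWithinAt
  have hiv := hint fun t ht => (hv t ht).continuousAt
  have hiu := hint fun t ht => (hu t ht).continuousAt
  have hvpow : ∀ n : ℤ, (n : ℂ) * (∮ z in C(0, 1), v z * z ^ (n - 1)) =
      ∮ z in C(0, 1), u z * z ^ n := fun n => by
    have h : (∮ z in C(0, 1), ((n : ℂ) * (v z * z ^ (n - 1)) - u z * z ^ n)) = 0 :=
      circleIntegral.integral_eq_zero_of_hasDerivWithinAt (f := fun z => v z * z ^ n)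
        zero_le_one fun z hz => by
          have := (hv z (hne z hz)).mul (hasDerivAt_zpow n z (Or.inl (hne z hz)))
          exact (this.congr_deriv (by ring)).hasDerivWithinAt
    rw [circleIntegral.integral_sub (circleIntegrable_const_mul (hiv _) _) (hiu n),
      circleIntegral.integral_const_mul] at h
    exact sub_eq_zero.mp h
  have hupow : ((k : ℂ) + 2) * (∮ z in C(0, 1), u z * z ^ (k + 1)) =
      (lam : ℂ) * (lam + 1) * (∮ z in C(0, 1), v z * z ^ k) +
        a ^ 2 * ∮ z in C(0, 1), v z * z ^ (k + 1) := by
    have h : (∮ z in C(0, 1), (((k : ℂ) + 2) * (u z * z ^ (k + 1)) -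
        ((lam : ℂ) * (lam + 1) * (v z * z ^ k) + a ^ 2 * (v z * z ^ (k + 1))))) = 0 :=
      circleIntegral.integral_eq_zero_of_hasDerivWithinAt (f := fun z => u z * z ^ (k + 2))
        zero_le_one fun z hz => by
          have h0 := hne z hz
          have := (hu z h0).mul (hasDerivAt_zpow (k + 2) z (Or.inl h0))
          refine (this.congr_deriv ?_).hasDerivWithinAt
          rw [show k + 2 - 1 = k + 1 by ring, zpow_add₀ h0 k 2, zpow_add_one₀ h0]
          push_cast
          field_simp
          ring
    rw [circleIntegral.integral_sub (circleIntegrable_const_mul (hiu _) _)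
        ((circleIntegrable_const_mul (hiv _) _).fun_add (circleIntegrable_const_mul (hiv _) _)),
      circleIntegral.integral_add (circleIntegrable_const_mul (hiv _) _) (circleIntegrable_const_mul (hiv _) _)] at h
    simp only [circleIntegral.integral_const_mul] at h
    exact sub_eq_zero.mp h
  have h1 := hvpow (k + 1)
  rw [add_sub_cancel_right] at h1
  rw [← h1] at hupow
  push_cast at hupow
  linear_combination hupow

/-- If `a ≠ 0`, a single-valued solution is determined by its moment of order `-λ-2`. -/
theorem oper_solution_eq_zero (ha : a ≠ 0)
    (hu : ∀ t : ℂ, t ≠ 0 →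
      HasDerivAt u (-((lam : ℂ) * (lam + 1) * (t⁻¹) ^ 2 + a ^ 2 * t⁻¹) * v t) t)
    (hv : ∀ t : ℂ, t ≠ 0 → HasDerivAt v (-u t) t)
    (hm : (∮ z in C(0, 1), v z * z ^ (-(lam : ℤ) - 2)) = 0) : u 1 = 0 ∧ v 1 = 0 := by
  have hrec := oper_moment_recurrence hu hv
  have hmom : ∀ n : ℤ, (∮ z in C(0, 1), v z * z ^ n) = 0 := fun n => by
    induction n using Int.inductionOn' (b := -(lam : ℤ) - 2) with
    | zero => exact hm
    | succ k _ ih =>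
      have h := hrec k
      rw [ih, mul_zero] at h
      exact (mul_eq_zero.mp h.symm).resolve_left (pow_ne_zero 2 ha)
    | pred k hk ih =>
      have h := hrec (k - 1)
      rw [sub_add_cancel, ih, mul_zero] at h
      refine (mul_eq_zero.mp h).resolve_left (mul_ne_zero ?_ ?_)
      · have : (k - 1) - (lam : ℤ) + 1 ≠ 0 := by omega
        exact_mod_cast this
      · have : (k - 1) + (lam : ℤ) + 2 ≠ 0 := by omega
        exact_mod_cast this
  have hzero : ∀ z : ℂ, ‖z‖ = 1 → v z = 0 := fun z hz =>
    eq_zero_of_circleIntegral_mul_zpow_eq_zero (fun t ht =>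
      (hv t (ne_zero_of_mem_unit_sphere ⟨t, ht⟩)).continuousAt.continuousWithinAt) hmom hz
  refine ⟨?_, hzero 1 norm_one⟩
  have hc : HasDerivAt (fun θ : ℝ => v (circleMap 0 1 θ)) (-u 1 * Complex.I) 0 := by
    have h1 : circleMap 0 1 0 = 1 := by simp [circleMap]
    have h := (hasDerivAt_circleMap 0 1 0)
    have h2 := HasDerivAt.comp (0 : ℝ) (hv _ (by rw [h1]; exact one_ne_zero)) h
    rw [h1, one_mul] at h2
    exact h2
  have hconst : (fun θ : ℝ => v (circleMap 0 1 θ)) = fun _ => 0 :=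
    funext fun θ => hzero _ (by simp)
  rw [hconst] at hc
  simpa using hc.unique (hasDerivAt_const (0 : ℝ) (0 : ℂ))

end Moments

/-- There exists a holomorphic fundamental matrix solution `Φ : ℂ∖{0} → GL₂(ℂ)` of
`Φ'(t) = −A(t)·Φ(t)` (i.e. the connection `d + A(t)dt` has trivial monodromy)
if and only if `a = 0`. -/
theorem exists_global_fundamental_solution_iff (lam : ℕ) (a : ℂ) :
    (∃ Φ : ℂ → Matrix (Fin 2) (Fin 2) ℂ,
      (∀ t : ℂ, t ≠ 0 → IsUnit (Φ t)) ∧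
      (∀ t : ℂ, t ≠ 0 → ∀ i j : Fin 2,
        HasDerivAt (fun s => Φ s i j) (((-(operConnMatrix lam a t)) * Φ t) i j) t)) ↔
    a = 0 := by
  constructor
  · rintro ⟨Φ, hunit, hΦ⟩
    by_contra ha
    let m : Fin 2 → ℂ := fun j => ∮ z in C(0, 1), Φ z 1 j * z ^ (-(lam : ℤ) - 2)
    obtain ⟨c, hc, hcm⟩ : ∃ c : Fin 2 → ℂ, c ≠ 0 ∧ c 0 * m 0 + c 1 * m 1 = 0 := by
      by_cases h : m 0 = 0
      · exact ⟨![1, 0], fun h' => one_ne_zero (congrFun h' 0), by simp [h]⟩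
      · refine ⟨![-m 1, m 0], fun h' => h (congrFun h' 1), ?_⟩
        simp only [cons_val_zero, cons_val_one]
        ring
    have hint : ∀ j, CircleIntegrable (fun z => Φ z 1 j * z ^ (-(lam : ℤ) - 2)) 0 1 := fun j =>
      ContinuousOn.circleIntegrable zero_le_one fun z hz =>
        have h0 : z ≠ 0 := ne_zero_of_mem_unit_sphere ⟨z, hz⟩
        ((hΦ z h0 1 j).continuousAt.mul
          (continuousAt_zpow₀ z _ (Or.inl h0))).continuousWithinAt
    have hsol := oper_solution_eq_zero (lam := lam) (a := a)
      (u := fun t => c 0 * Φ t 0 0 + c 1 * Φ t 0 1)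
      (v := fun t => c 0 * Φ t 1 0 + c 1 * Φ t 1 1) ha
      (fun t ht => (((hΦ t ht 0 0).const_mul (c 0)).add
        ((hΦ t ht 0 1).const_mul (c 1))).congr_deriv (by
          simp [operConnMatrix, Matrix.mul_apply, Fin.sum_univ_two]; ring))
      (fun t ht => (((hΦ t ht 1 0).const_mul (c 0)).add
        ((hΦ t ht 1 1).const_mul (c 1))).congr_deriv (by
          simp [operConnMatrix, Matrix.mul_apply, Fin.sum_univ_two]; ring))
      (by
        simp only [add_mul, mul_assoc]
        rw [circleIntegral.integral_add (circleIntegrable_const_mul (hint 0) _) (circleIntegrable_const_mul (hint 1) _),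
          circleIntegral.integral_const_mul, circleIntegral.integral_const_mul]
        exact hcm)
    refine hc (Matrix.mulVec_injective_of_isUnit (hunit 1 one_ne_zero) ?_)
    rw [mulVec_zero]
    funext i
    fin_cases i
    · simpa [mulVec, dotProduct, Fin.sum_univ_two, mul_comm (c _)] using hsol.1
    · simpa [mulVec, dotProduct, Fin.sum_univ_two, mul_comm (c _)] using hsol.2
  · rintro rfl
    refine ⟨fun t => !![-((lam : ℂ) + 1) * t ^ (lam : ℤ), (lam : ℂ) * t ^ (-(lam : ℤ) - 1);
      t ^ ((lam : ℤ) + 1), t ^ (-(lam : ℤ))], fun t ht => ?_, fun t ht i j => ?_⟩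
    · rw [Matrix.isUnit_iff_isUnit_det, det_fin_two_of, isUnit_iff_ne_zero]
      have h : -((lam : ℂ) + 1) * t ^ (lam : ℤ) * t ^ (-(lam : ℤ)) -
          (lam : ℂ) * t ^ (-(lam : ℤ) - 1) * t ^ ((lam : ℤ) + 1) = -((2 * lam + 1 : ℕ) : ℂ) := by
        rw [mul_assoc, mul_assoc, ← zpow_add₀ ht, ← zpow_add₀ ht]
        rw [add_neg_cancel, show -(lam : ℤ) - 1 + (lam + 1) = 0 by ring, zpow_zero]
        push_cast
        ring
      rw [h]
      exact neg_ne_zero.mpr (Nat.cast_ne_zero.mpr (by omega))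
    · have hz : ∀ n : ℤ, HasDerivAt (fun s : ℂ => s ^ n) (n * t ^ (n - 1)) t := fun n =>
        hasDerivAt_zpow n t (Or.inl ht)
      fin_cases i <;> fin_cases j <;>
        simp only [operConnMatrix, Matrix.mul_apply, Fin.sum_univ_two, Fin.zero_eta, Fin.mk_one,
          of_apply, cons_val_zero, cons_val_one, cons_val', cons_val_fin_one, Matrix.neg_apply, Fin.isValue]
      · refine ((hz lam).const_mul _).congr_deriv ?_
        rw [zpow_add_one₀ ht, zpow_sub_one₀ ht]
        push_cast
        field_simp
        ring
      · refine ((hz _).const_mul _).congr_deriv ?_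
        rw [zpow_sub_one₀ ht, zpow_sub_one₀ ht]
        push_cast
        field_simp
        ring
      · refine (hz _).congr_deriv ?_
        rw [add_sub_cancel_right]
        push_cast
        ring
      · refine (hz _).congr_deriv ?_
        push_cast
        ring
end

section
/- Let n ≥ 1 and k be natural numbers, and let w : Fin n → ℕ be weights with w(i) ≥ 1 for all i, defining the weighted degree of a monomial ∏ xᵢ^{eᵢ} to be Σ w(i)·eᵢ. Let P₁, …, P_k be nonzero polynomials in ℂ[x₁, …, x_n], and for each j let Q_j be the weighted-homogeneous component of P_j of top weighted degree. If the set of common zeros of Q₁, …, Q_k in ℂⁿ is finite, then the set of common zeros of P₁, …, P_k in ℂⁿ is finite. -/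
open MvPolynomial

namespace MvPolynomial

/-- The component of top weighted degree. -/
noncomputable def weightedLeadingForm {σ R : Type*} [CommSemiring R] (w : σ → ℕ)
    (p : MvPolynomial σ R) : MvPolynomial σ R :=
  weightedHomogeneousComponent w (weightedTotalDegree w p) p

theorem IsWeightedHomogeneous.eval_pow_mul {σ R : Type*} [Fintype σ] [CommSemiring R]
    {w : σ → ℕ} {p : MvPolynomial σ R} {d : ℕ} (hp : p.IsWeightedHomogeneous w d)
    (t : R) (x : σ → R) : eval (fun i => t ^ w i * x i) p = t ^ d * eval x p := by
  rw [eval_eq', eval_eq', Finset.mul_sum]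
  refine Finset.sum_congr rfl fun s hs => ?_
  have hd : ∑ i, w i * s i = d := by
    rw [← hp (mem_support_iff.mp hs), Finsupp.weight_eq_sum]
    simp [mul_comm]
  simp only [mul_pow, Finset.prod_mul_distrib, ← pow_mul, Finset.prod_pow_eq_pow_sum, hd]
  ring

/-- A finite set cut out by weighted homogeneous polynomials contains at most the origin. -/
theorem eq_zero_of_finite_zeroSet_of_isWeightedHomogeneous {σ ι K : Type*} [Fintype σ] [Field K]
    [IsAlgClosed K] {w : σ → ℕ} (hw : ∀ i, 0 < w i) {Q : ι → MvPolynomial σ K} {d : ι → ℕ}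
    (hd : ∀ j, (Q j).IsWeightedHomogeneous w (d j))
    (hQ : {x : σ → K | ∀ j, eval x (Q j) = 0}.Finite)
    {x : σ → K} (hx : ∀ j, eval x (Q j) = 0) : x = 0 := by
  have := IsAlgClosed.instInfinite (K := K)
  by_contra hne
  obtain ⟨i, hi⟩ := Function.ne_iff.mp hne
  refine Set.infinite_univ (α := K) ((hQ.image fun y => y i).subset fun c _ => ?_)
  obtain ⟨t, ht⟩ := IsAlgClosed.exists_pow_nat_eq (c / x i) (hw i)
  refine ⟨fun i => t ^ w i * x i, fun j => ?_, ?_⟩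
  · rw [(hd j).eval_pow_mul, hx, mul_zero]
  · simp only [ht]
    exact div_mul_cancel₀ c hi

theorem sub_weightedLeadingForm_mem_restrictSupport {σ R : Type*} [CommRing R] (w : σ → ℕ)
    (p : MvPolynomial σ R) : p - weightedLeadingForm w p ∈
      restrictSupport R {s | Finsupp.weight w s < weightedTotalDegree w p} := by
  classical
  rw [mem_restrictSupport_iff]
  intro s hs
  rw [Finset.mem_coe, mem_support_iff, coeff_sub, weightedLeadingForm,
    coeff_weightedHomogeneousComponent] at hs
  split_ifs at hs with h
  · simp at hs
  · exact lt_of_le_of_ne (le_weightedTotalDegree w (mem_support_iff.mpr (by simpa using hs))) h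

open scoped Pointwise in
/-- A weighted homogeneous element of the ideal of leading forms is, modulo terms of smaller
weight, an element of the original ideal. -/
theorem IsWeightedHomogeneous.mem_span_sup_restrictSupport {σ ι R : Type*} [CommRing R]
    {w : σ → ℕ} {P : ι → MvPolynomial σ R} {f : MvPolynomial σ R} {m : ℕ}
    (hf : f.IsWeightedHomogeneous w m)
    (hfQ : f ∈ Ideal.span (Set.range fun j => weightedLeadingForm w (P j))) :
    f ∈ (Ideal.span (Set.range P)).restrictScalars R ⊔
      restrictSupport R {s | Finsupp.weight w s < m} := by
  obtain ⟨c, rfl⟩ := Finsupp.mem_ideal_span_range_iff_exists_finsupp.mp hfQ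
  rw [← hf.weightedHomogeneousComponent_same, Finsupp.sum, map_sum]
  refine Submodule.sum_mem _ fun j _ => ?_
  rw [(c j).as_sum, Finset.sum_mul, map_sum]
  refine Submodule.sum_mem _ fun s _ => ?_
  set a := monomial s (coeff s (c j))
  have ha : (a * weightedLeadingForm w (P j)).IsWeightedHomogeneous w
      (Finsupp.weight w s + weightedTotalDegree w (P j)) :=
    (isWeightedHomogeneous_monomial w s _ rfl).mul
      (weightedHomogeneousComponent_isWeightedHomogeneous _ _)
  by_cases hm : Finsupp.weight w s + weightedTotalDegree w (P j) = m
  · subst hm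
    rw [ha.weightedHomogeneousComponent_same,
      show a * weightedLeadingForm w (P j) =
        a * P j - a * (P j - weightedLeadingForm w (P j)) by ring]
    refine sub_mem (Submodule.mem_sup_left (Ideal.mul_mem_left _ _ (Ideal.subset_span ⟨j, rfl⟩)))
      (Submodule.mem_sup_right ?_)
    have hmul : a * (P j - weightedLeadingForm w (P j)) ∈ restrictSupport R
        (({s} : Set (σ →₀ ℕ)) + {t | Finsupp.weight w t < weightedTotalDegree w (P j)}) := by
      rw [restrictSupport_add]
      exact Submodule.mul_mem_mul ((monomial_mem_restrictSupport R).mpr (.inl rfl))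
        (sub_weightedLeadingForm_mem_restrictSupport w (P j))
    refine restrictSupport_mono R ?_ hmul
    rintro _ ⟨_, rfl, t, ht, rfl⟩
    simpa using ht
  · rw [ha.weightedHomogeneousComponent_ne _ (Ne.symm hm)]
    exact zero_mem _

/-- If the ideal of leading forms contains a power of every variable, then the quotient by the
original ideal is a finite module. -/
theorem finite_quotient_of_X_pow_mem_span_weightedLeadingForm {σ ι R : Type*} [Finite σ]
    [CommRing R] (w : σ → ℕ) (P : ι → MvPolynomial σ R) (N : σ → ℕ)
    (hN : ∀ i, X i ^ N i ∈ Ideal.span (Set.range fun j => weightedLeadingForm w (P j))) :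
    Module.Finite R (MvPolynomial σ R ⧸ Ideal.span (Set.range P)) := by
  set I := Ideal.span (Set.range P)
  set B : Set (σ →₀ ℕ) := {s | ∀ i, s i < N i}
  have hB : B.Finite := by
    refine ((Set.Finite.pi' fun i => Set.finite_Iio (N i)).preimage
      (DFunLike.coe_injective (F := σ →₀ ℕ)).injOn).subset fun s hs => hs
  have key (m : ℕ) : restrictSupport R {s | Finsupp.weight w s < m} ≤
      I.restrictScalars R ⊔ restrictSupport R B := by
    induction m with
    | zero => simp [restrictSupport_eq_span]
    | succ m ih =>
      rw [restrictSupport_eq_span, Submodule.span_le]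
      rintro _ ⟨s, hs, rfl⟩
      by_cases hsB : s ∈ B
      · exact Submodule.mem_sup_right ((monomial_mem_restrictSupport R).mpr (.inl hsB))
      obtain ⟨i, hi⟩ : ∃ i, N i ≤ s i := by simpa [B] using hsB
      have hmem : monomial s (1 : R) ∈
          Ideal.span (Set.range fun j => weightedLeadingForm w (P j)) := by
        have hle : Finsupp.single i (N i) ≤ s := by simpa using hi
        rw [← tsub_add_cancel_of_le hle, ← one_mul (1 : R), ← monomial_mul,
          ← X_pow_eq_monomial]
        exact Ideal.mul_mem_left _ _ (hN i)
      refine (sup_le le_sup_left ((restrictSupport_mono R fun t ht => ?_).trans ih))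
        ((isWeightedHomogeneous_monomial w s (1 : R) rfl).mem_span_sup_restrictSupport hmem)
      exact lt_of_lt_of_le ht (Nat.lt_succ_iff.mp hs)
  have htop : I.restrictScalars R ⊔ restrictSupport R B = ⊤ := by
    refine eq_top_iff.mpr fun f _ => key (weightedTotalDegree w f + 1) ?_
    exact fun s hs => Nat.lt_succ_of_le (le_weightedTotalDegree w hs)
  have hfg : (restrictSupport R B).FG := by
    rw [restrictSupport_eq_span]
    exact Submodule.fg_span (hB.image _)
  refine ⟨?_⟩
  let q := (Ideal.Quotient.mkₐ R I).toLinearMap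
  have hq : (restrictSupport R B).map q = ⊤ := by
    have h := congrArg (Submodule.map q) htop
    have hI : (I.restrictScalars R).map q = ⊥ := by
      rw [eq_bot_iff, Submodule.map_le_iff_le_comap]
      exact fun f hf => Ideal.Quotient.eq_zero_iff_mem.mpr hf
    rwa [Submodule.map_sup, hI, bot_sup_eq, Submodule.map_top,
      LinearMap.range_eq_top.mpr (Ideal.Quotient.mkₐ_surjective R I)] at h
  exact hq ▸ hfg.map q

theorem finite_zeroLocus_of_finite_quotient {σ K : Type*} [Field K]
    (I : Ideal (MvPolynomial σ K)) [Module.Finite K (MvPolynomial σ K ⧸ I)] :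
    (zeroLocus K I).Finite := by
  let coords (φ : MvPolynomial σ K ⧸ I →ₐ[K] K) : σ → K := fun i => φ (Ideal.Quotient.mk I (X i))
  refine (Set.finite_range coords).subset fun x hx => ?_
  refine ⟨Ideal.Quotient.liftₐ I (aeval x) hx, _root_.funext fun i => ?_⟩
  exact (Ideal.Quotient.lift_mk I _ hx).trans (aeval_X x i)

end MvPolynomial

/-- If the common zero set of the top weighted-homogeneous components (with respect to
positive weights `w`) of nonzero polynomials `P₁, …, P_k` is finite, then the common zero
set of `P₁, …, P_k` themselves is finite. -/
theorem finite_zeroSet_of_finite_leading_zeroSet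
    (n k : ℕ) (hn : 1 ≤ n) (w : Fin n → ℕ) (hw : ∀ i, 1 ≤ w i)
    (P : Fin k → MvPolynomial (Fin n) ℂ) (hP : ∀ j, P j ≠ 0)
    (hQ : {x : Fin n → ℂ | ∀ j,
        eval x (weightedHomogeneousComponent w (weightedTotalDegree w (P j)) (P j)) = 0}.Finite) :
    {x : Fin n → ℂ | ∀ j, eval x (P j) = 0}.Finite := by
  have hrad (i : Fin n) : ∃ N : ℕ, (X i : MvPolynomial (Fin n) ℂ) ^ N ∈
      Ideal.span (Set.range fun j => weightedLeadingForm w (P j)) := by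
    rw [← Ideal.mem_radical_iff, ← vanishingIdeal_zeroLocus_eq_radical (K := ℂ),
      mem_vanishingIdeal_iff]
    intro x hx
    rw [zeroLocus_span] at hx
    have hx0 : x = 0 := eq_zero_of_finite_zeroSet_of_isWeightedHomogeneous hw
      (fun j => weightedHomogeneousComponent_isWeightedHomogeneous _ (P j)) hQ
      fun j => by simpa [aeval_eq_eval, weightedLeadingForm] using hx _ ⟨j, rfl⟩
    simp [hx0]
  choose N hN using hrad
  have := finite_quotient_of_X_pow_mem_span_weightedLeadingForm w P N hN
  refine (finite_zeroLocus_of_finite_quotient (Ideal.span (Set.range P))).subset fun x hx => ?_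
  rw [zeroLocus_span]
  rintro _ ⟨j, rfl⟩
  simpa [aeval_eq_eval] using hx j
end

section
/- Let λ be a nonnegative integer and let b ∈ ℂ∖{0}. Then the set of c ∈ ℂ for which the complex vector space of holomorphic functions ψ : ℂ∖{0} → ℂ satisfying ψ''(t) = (λ(λ+1)·t⁻² + c·t⁻¹ + b)·ψ(t) for all t ∈ ℂ∖{0} has dimension 2 is a finite subset of ℂ. -/
/-- The space of global holomorphic solutions on `ℂ ∖ {0}` of the equation
`ψ''(t) = (λ(λ+1)·t⁻² + c·t⁻¹ + b)·ψ(t)`, modelled as functions `ℂ → ℂ` vanishing at `0`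
(a function on the punctured plane being identified with its extension by zero),
holomorphic at every `t ≠ 0` and satisfying the equation there. -/
def slTwoIrregOperSolutionSet (lam : ℕ) (b c : ℂ) : Set (ℂ → ℂ) :=
  {ψ | ψ 0 = 0 ∧ (∀ t : ℂ, t ≠ 0 → DifferentiableAt ℂ ψ t) ∧
    (∀ t : ℂ, t ≠ 0 → DifferentiableAt ℂ (deriv ψ) t) ∧
    ∀ t : ℂ, t ≠ 0 →
      deriv (deriv ψ) t =
        ((lam : ℂ) * ((lam : ℂ) + 1) * (t⁻¹) ^ 2 + c * t⁻¹ + b) * ψ t}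

open Polynomial in
/-- The obstruction polynomials: up to normalisation, the Frobenius coefficients at the exponent
`-λ`, as polynomials in `c`. -/
noncomputable def frobeniusPoly (lam : ℕ) (b : ℂ) : ℕ → ℂ[X]
  | 0 => 1
  | 1 => X
  | j + 2 => X * frobeniusPoly lam b (j + 1) +
      C (b * (((j : ℂ) + 1) * ((j : ℂ) + 1 - (2 * lam + 1)))) * frobeniusPoly lam b j

open Polynomial in
theorem frobeniusPoly_monic_natDegree (lam : ℕ) (b : ℂ) (j : ℕ) :
    ((frobeniusPoly lam b j).Monic ∧ (frobeniusPoly lam b j).natDegree = j) ∧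
      (frobeniusPoly lam b (j + 1)).Monic ∧ (frobeniusPoly lam b (j + 1)).natDegree = j + 1 := by
  induction j with
  | zero => simp [frobeniusPoly, monic_X]
  | succ j ih =>
    obtain ⟨⟨hm, hd⟩, hm', hd'⟩ := ih
    refine ⟨⟨hm', hd'⟩, ?_⟩
    have hX : (X * frobeniusPoly lam b (j + 1)).Monic := monic_X.mul hm'
    have hXd : (X * frobeniusPoly lam b (j + 1)).natDegree = j + 2 := by
      rw [monic_X.natDegree_mul hm', hd', natDegree_X]; ring
    have hlow : (C (b * (((j : ℂ) + 1) * ((j : ℂ) + 1 - (2 * lam + 1)))) *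
        frobeniusPoly lam b j).natDegree ≤ j :=
      (natDegree_C_mul_le _ _).trans hd.le
    have hlt : (C (b * (((j : ℂ) + 1) * ((j : ℂ) + 1 - (2 * lam + 1)))) *
        frobeniusPoly lam b j).degree < (X * frobeniusPoly lam b (j + 1)).degree := by
      apply degree_lt_degree
      omega
    rw [frobeniusPoly]
    refine ⟨hX.add_of_left hlt, ?_⟩
    rw [natDegree_add_eq_left_of_degree_lt hlt, hXd]

theorem frobeniusPoly_ne_zero (lam : ℕ) (b : ℂ) (j : ℕ) : frobeniusPoly lam b j ≠ 0 :=
  (frobeniusPoly_monic_natDegree lam b j).1.1.ne_zero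

/-- The Frobenius recursion expresses each coefficient through the first one. -/
theorem prod_mul_eq_eval_frobeniusPoly_mul {lam : ℕ} {b c : ℂ} {u : ℕ → ℂ}
    (h1 : (1 : ℂ) * (1 - (2 * lam + 1)) * u 1 = c * u 0)
    (h : ∀ j : ℕ, ((j : ℂ) + 2) * ((j : ℂ) + 2 - (2 * lam + 1)) * u (j + 2) =
      c * u (j + 1) + b * u j) (j : ℕ) :
    (∏ i ∈ Finset.range j, (((i : ℂ) + 1) * ((i : ℂ) + 1 - (2 * lam + 1)))) * u j =
      (frobeniusPoly lam b j).eval c * u 0 := by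
  induction j using Nat.twoStepInduction with
  | zero => simp [frobeniusPoly]
  | one => simpa [frobeniusPoly] using h1
  | more j ih ih' =>
    simp only [frobeniusPoly, Polynomial.eval_add, Polynomial.eval_mul, Polynomial.eval_X,
      Polynomial.eval_C]
    rw [Finset.prod_range_succ] at ih' ⊢
    rw [Finset.prod_range_succ]
    push_cast
    linear_combination c * ih' +
      b * (((j : ℂ) + 1) * ((j : ℂ) + 1 - (2 * lam + 1))) * ih +
      (∏ i ∈ Finset.range j, (((i : ℂ) + 1) * ((i : ℂ) + 1 - (2 * lam + 1)))) *
        (((j : ℂ) + 1) * ((j : ℂ) + 1 - (2 * lam + 1))) * h j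

/-- If the obstruction polynomial does not vanish at `c`, a solution of the Frobenius recursion
whose coefficient at the second exponent vanishes is zero. -/
theorem frobenius_recursion_eq_zero {lam : ℕ} {b c : ℂ} {u : ℕ → ℂ}
    (h1 : (1 : ℂ) * (1 - (2 * lam + 1)) * u 1 = c * u 0)
    (h : ∀ j : ℕ, ((j : ℂ) + 2) * ((j : ℂ) + 2 - (2 * lam + 1)) * u (j + 2) =
      c * u (j + 1) + b * u j)
    (hc : (frobeniusPoly lam b (2 * lam + 1)).eval c ≠ 0) (hu : u (2 * lam + 1) = 0) (j : ℕ) :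
    u j = 0 := by
  have h0 : u 0 = 0 := by
    have := prod_mul_eq_eval_frobeniusPoly_mul h1 h (2 * lam + 1)
    rw [hu, mul_zero] at this
    exact (mul_eq_zero.1 this.symm).resolve_left hc
  induction j using Nat.twoStepInduction with
  | zero => exact h0
  | one =>
    rcases Nat.eq_zero_or_pos lam with rfl | hl
    · simpa using hu
    · rw [h0, mul_zero] at h1
      refine (mul_eq_zero.1 h1).resolve_left ?_
      have : (lam : ℂ) ≠ 0 := by exact_mod_cast hl.ne'
      simpa using this
  | more j ih ih' =>
    by_cases hj : j + 2 = 2 * lam + 1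
    · rw [hj, hu]
    · have := h j
      rw [ih, ih', mul_zero, mul_zero, add_zero] at this
      refine (mul_eq_zero.1 this).resolve_left (mul_ne_zero ?_ (sub_ne_zero.2 ?_))
      · exact_mod_cast (Nat.succ_ne_zero (j + 1))
      · exact_mod_cast hj

/-- A sequence with at most geometric growth at rate `r` that is controlled by its later terms with
total weight `≤ 1/2` vanishes. -/
theorem eq_zero_of_norm_le_later_terms {v : ℕ → ℂ} {A B r K : ℝ} (hA : 0 ≤ A) (hB : 0 ≤ B)
    (hr : 0 < r) (hsmall : A * r + B * r ^ 2 ≤ 1 / 2) (hK : ∀ k, ‖v k‖ ≤ K * r ^ k)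
    (hv : ∀ k, ‖v k‖ ≤ A * ‖v (k + 1)‖ + B * ‖v (k + 2)‖) (k : ℕ) : v k = 0 := by
  have hK0 : 0 ≤ K := by simpa using (norm_nonneg _).trans (hK 0)
  have key : ∀ i k : ℕ, ‖v k‖ ≤ K * (1 / 2) ^ i * r ^ k := by
    intro i
    induction i with
    | zero => simpa using hK
    | succ i ih =>
      intro k
      calc ‖v k‖ ≤ A * ‖v (k + 1)‖ + B * ‖v (k + 2)‖ := hv k
        _ ≤ A * (K * (1 / 2) ^ i * r ^ (k + 1)) + B * (K * (1 / 2) ^ i * r ^ (k + 2)) := by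
          gcongr <;> apply ih
        _ = (A * r + B * r ^ 2) * (K * (1 / 2) ^ i * r ^ k) := by ring
        _ ≤ 1 / 2 * (K * (1 / 2) ^ i * r ^ k) := by gcongr
        _ = K * (1 / 2) ^ (i + 1) * r ^ k := by ring
  have hlim : Filter.Tendsto (fun i : ℕ => K * (1 / 2 : ℝ) ^ i * r ^ k) Filter.atTop
      (nhds (K * 0 * r ^ k)) :=
    ((tendsto_pow_atTop_nhds_zero_of_lt_one (by norm_num) (by norm_num)).const_mul K).mul_const _
  have := ge_of_tendsto' hlim (fun i => key i k)
  simpa using this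

/-- A function continuous on a circle, all of whose Laurent moments vanish, is zero there. -/
theorem eq_zero_on_circle_of_moments_eq_zero {ψ : ℂ → ℂ} {r : ℝ} (hr : 0 < r)
    (hψ : ContinuousOn ψ (Metric.sphere 0 r))
    (h : ∀ n : ℤ, circleIntegral (fun z => z ^ n * ψ z) 0 r = 0) (θ : ℝ) :
    ψ (circleMap 0 r θ) = 0 := by
  have : Fact (0 < 2 * Real.pi) := ⟨Real.two_pi_pos⟩
  have hπ : (Real.pi : ℂ) ≠ 0 := by exact_mod_cast Real.pi_ne_zero
  have hmap : ∀ x : ℝ, (r : ℂ) * (AddCircle.toCircle (x : AddCircle (2 * Real.pi)) : ℂ) =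
      circleMap 0 r x := by
    intro x
    rw [AddCircle.toCircle_apply_mk, Circle.coe_exp, circleMap, zero_add,
      div_self Real.two_pi_pos.ne', one_mul]
  have hcont : Continuous fun x : AddCircle (2 * Real.pi) =>
      ψ ((r : ℂ) * (AddCircle.toCircle x : ℂ)) := by
    refine hψ.comp_continuous (by fun_prop) fun x => ?_
    rw [mem_sphere_zero_iff_norm, norm_mul, Circle.norm_coe, mul_one, Complex.norm_real,
      Real.norm_of_nonneg hr.le]
  let f : C(AddCircle (2 * Real.pi), ℂ) := ⟨_, hcont⟩
  have hcoeff : fourierCoeff f = 0 := by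
    funext n
    rw [fourierCoeff_eq_intervalIntegral _ n 0, zero_add]
    have hn := h (-n - 1)
    rw [circleIntegral] at hn
    have hr' : (r : ℂ) ≠ 0 := by exact_mod_cast hr.ne'
    have heq : ∀ x : ℝ, deriv (circleMap 0 r) x • ((circleMap 0 r x) ^ (-n - 1) *
        ψ (circleMap 0 r x)) = (Complex.I * (r : ℂ) ^ (-n)) *
          (fourier (-n) (x : AddCircle (2 * Real.pi)) • f x) := by
      intro x
      have hne : circleMap 0 r x ≠ 0 := circleMap_ne_center hr.ne'
      have hfx : f (x : AddCircle (2 * Real.pi)) = ψ (circleMap 0 r x) := by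
        rw [← hmap x]; rfl
      have hpow : circleMap 0 r x ^ (-n) =
          (r : ℂ) ^ (-n) * fourier (-n) (x : AddCircle (2 * Real.pi)) := by
        rw [fourier_coe_apply, circleMap, zero_add, mul_zpow, ← Complex.exp_int_mul]
        congr 2
        push_cast
        field_simp
      rw [deriv_circleMap, hfx, zpow_sub_one₀ hne, smul_eq_mul, smul_eq_mul, hpow]
      field_simp
    simp_rw [heq] at hn
    rw [intervalIntegral.integral_const_mul] at hn
    rw [(mul_eq_zero.1 hn).resolve_left (mul_ne_zero Complex.I_ne_zero (zpow_ne_zero _ hr'))]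
    simp
  have hsum := has_pointwise_sum_fourier_series_of_summable (f := f)
    (by rw [hcoeff]; exact summable_zero) (θ : AddCircle (2 * Real.pi))
  rw [hcoeff] at hsum
  have : f (θ : AddCircle (2 * Real.pi)) = 0 := hsum.unique (by simp)
  rw [← hmap θ]
  exact this

/-- A holomorphic function on the punctured plane that vanishes on a circle around `0` is zero. -/
theorem eq_zero_of_eq_zero_on_circle {ψ : ℂ → ℂ} {r : ℝ} (hr : 0 < r)
    (hψ : ∀ t : ℂ, t ≠ 0 → DifferentiableAt ℂ ψ t)
    (h : ∀ θ : ℝ, ψ (circleMap 0 r θ) = 0) {t : ℂ} (ht : t ≠ 0) : ψ t = 0 := by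
  have han : AnalyticOnNhd ℂ ψ {0}ᶜ :=
    DifferentiableOn.analyticOnNhd (fun t ht => (hψ t ht).differentiableWithinAt)
      isOpen_compl_singleton
  have hconn : IsPreconnected ({0}ᶜ : Set ℂ) :=
    (isConnected_compl_singleton_of_one_lt_rank (by simp) _).isPreconnected
  have hne : circleMap 0 r 0 ≠ 0 := circleMap_ne_center hr.ne'
  have htend : Filter.Tendsto (circleMap 0 r) (nhdsWithin 0 {0}ᶜ)
      (nhdsWithin (circleMap 0 r 0) {circleMap 0 r 0}ᶜ) :=
    (hasDerivAt_circleMap 0 r 0).tendsto_nhdsNE (mul_ne_zero hne Complex.I_ne_zero)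
  exact han.eqOn_zero_of_preconnected_of_frequently_eq_zero hconn hne
    (htend.frequently (Filter.Frequently.of_forall h)) ht

/-- On a circle, a power times a function holomorphic off `0` is integrable. -/
theorem circleIntegrable_zpow_mul {ψ : ℂ → ℂ} (hψ : ∀ t : ℂ, t ≠ 0 → DifferentiableAt ℂ ψ t)
    {r : ℝ} (hr : 0 < r) (n : ℤ) : CircleIntegrable (fun z => z ^ n * ψ z) 0 r := by
  refine ContinuousOn.circleIntegrable hr.le fun z hz => ?_
  have hz0 : z ≠ 0 := Metric.ne_of_mem_sphere hz hr.ne'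
  exact ((continuousAt_zpow₀ z n (Or.inl hz0)).mul (hψ z hz0).continuousAt).continuousWithinAt

/-- The Laurent moments of a solution satisfy the Frobenius recursion. -/
theorem moment_recursion {lam : ℕ} {b c : ℂ} {ψ : ℂ → ℂ}
    (hψ : ψ ∈ slTwoIrregOperSolutionSet lam b c) {r : ℝ} (hr : 0 < r) (n : ℤ) :
    ((n : ℂ) * (n - 1) - lam * (lam + 1)) * circleIntegral (fun z => z ^ (n - 2) * ψ z) 0 r =
      c * circleIntegral (fun z => z ^ (n - 1) * ψ z) 0 r +
        b * circleIntegral (fun z => z ^ n * ψ z) 0 r := by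
  obtain ⟨-, hd, hd', hode⟩ := hψ
  have hint := circleIntegrable_zpow_mul hd hr
  have hzero : circleIntegral (fun z =>
      (lam * (lam + 1) - (n : ℂ) * (n - 1)) * (z ^ (n - 2) * ψ z) +
      c * (z ^ (n - 1) * ψ z) + b * (z ^ n * ψ z)) 0 r = 0 := by
    refine circleIntegral.integral_eq_zero_of_hasDerivWithinAt
      (f := fun z => z ^ n * deriv ψ z - n * (z ^ (n - 1) * ψ z)) hr.le fun z hz => ?_
    have hz0 : z ≠ 0 := Metric.ne_of_mem_sphere hz hr.ne'
    have h1 := (hasDerivAt_zpow n z (Or.inl hz0)).mul (hd' z hz0).hasDerivAt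
    have h2 := ((hasDerivAt_zpow (n - 1) z (Or.inl hz0)).mul (hd z hz0).hasDerivAt).const_mul
      (n : ℂ)
    convert! (h1.sub h2).hasDerivWithinAt using 1
    rw [hode z hz0, show n - 1 - 1 = n - 2 by ring, zpow_sub₀ hz0, zpow_sub₀ hz0]
    push_cast
    rw [zpow_one, zpow_ofNat]
    field_simp
    ring
  have hci : ∀ (a : ℂ) (m : ℤ), CircleIntegrable (fun z => a * (z ^ m * ψ z)) 0 r :=
    fun a m => (hint m).const_fun_smul (a := a)
  rw [circleIntegral.integral_add ((hci _ _).fun_add (hci _ _)) (hci _ _),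
    circleIntegral.integral_add (hci _ _) (hci _ _), circleIntegral.integral_const_mul,
    circleIntegral.integral_const_mul, circleIntegral.integral_const_mul] at hzero
  linear_combination -hzero

/-- Moments of a function continuous on a circle grow at most geometrically. -/
theorem exists_norm_moment_le {ψ : ℂ → ℂ} {r : ℝ} (hr : 0 < r)
    (hψ : ContinuousOn ψ (Metric.sphere 0 r)) (m : ℕ) :
    ∃ K : ℝ, ∀ k : ℕ, ‖circleIntegral (fun z => z ^ ((m : ℤ) + k) * ψ z) 0 r‖ ≤ K * r ^ k := by
  obtain ⟨M, hM⟩ := (isCompact_sphere (0 : ℂ) r).exists_bound_of_continuousOn hψ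
  refine ⟨2 * Real.pi * r * (r ^ m * M), fun k => ?_⟩
  have := circleIntegral.norm_integral_le_of_norm_le_const (c := 0)
    (f := fun z => z ^ ((m : ℤ) + k) * ψ z) (C := r ^ (m + k) * M) hr.le (fun z hz => by
      have hz' : ‖z‖ = r := by simpa using hz
      have : z ^ ((m : ℤ) + k) = z ^ (m + k) := by exact_mod_cast zpow_natCast z (m + k)
      rw [this, norm_mul, norm_pow, hz']
      gcongr
      exact hM z hz)
  refine this.trans_eq ?_
  ring

/-- A solution has a pole of order at most `λ` at `0`. -/
theorem moment_eq_zero {lam : ℕ} {b c : ℂ} {ψ : ℂ → ℂ}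
    (hψ : ψ ∈ slTwoIrregOperSolutionSet lam b c) {r : ℝ} (hr : 0 < r)
    (hsmall : ‖c‖ * r + ‖b‖ * r ^ 2 ≤ 1 / 2) (k : ℕ) :
    circleIntegral (fun z => z ^ ((lam : ℤ) + k) * ψ z) 0 r = 0 := by
  have hcont : ContinuousOn ψ (Metric.sphere 0 r) := fun z hz =>
    (hψ.2.1 z (Metric.ne_of_mem_sphere hz hr.ne')).continuousAt.continuousWithinAt
  obtain ⟨K, hK⟩ := exists_norm_moment_le hr hcont lam
  refine eq_zero_of_norm_le_later_terms
    (v := fun k : ℕ => circleIntegral (fun z => z ^ ((lam : ℤ) + k) * ψ z) 0 r)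
    (norm_nonneg c) (norm_nonneg b) hr hsmall hK (fun k => ?_) k
  have hrec := moment_recursion hψ hr ((lam : ℤ) + k + 2)
  rw [show (lam : ℤ) + k + 2 - 2 = lam + k by ring,
    show (lam : ℤ) + k + 2 - 1 = lam + (k + 1 : ℕ) by push_cast; ring,
    show (lam : ℤ) + k + 2 = lam + (k + 2 : ℕ) by push_cast; ring] at hrec
  have hcoef : (((lam : ℤ) + (k + 2 : ℕ) : ℤ) : ℂ) * (((lam : ℤ) + (k + 2 : ℕ) : ℤ) - 1) -
      lam * (lam + 1) = ((2 * lam + 2 + k * (2 * lam + 3 + k) : ℕ) : ℂ) := by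
    push_cast; ring
  rw [hcoef] at hrec
  have hone : (1 : ℝ) ≤ ‖((2 * lam + 2 + k * (2 * lam + 3 + k) : ℕ) : ℂ)‖ := by
    rw [Complex.norm_natCast]
    exact_mod_cast (by omega : 1 ≤ 2 * lam + 2 + k * (2 * lam + 3 + k))
  calc _ ≤ ‖((2 * lam + 2 + k * (2 * lam + 3 + k) : ℕ) : ℂ)‖ * _ :=
        le_mul_of_one_le_left (norm_nonneg _) hone
    _ = _ := (norm_mul _ _).symm
    _ ≤ _ := by
      rw [hrec, ← norm_mul, ← norm_mul]
      exact norm_add_le _ _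

/-- If the obstruction polynomial does not vanish at `c`, a solution is determined by its
Laurent coefficient at the exponent `λ + 1`. -/
theorem solution_eq_zero {lam : ℕ} {b c : ℂ} {ψ : ℂ → ℂ}
    (hψ : ψ ∈ slTwoIrregOperSolutionSet lam b c) {r : ℝ} (hr : 0 < r)
    (hsmall : ‖c‖ * r + ‖b‖ * r ^ 2 ≤ 1 / 2)
    (hc : (frobeniusPoly lam b (2 * lam + 1)).eval c ≠ 0)
    (h : circleIntegral (fun z => z ^ (-(lam : ℤ) - 2) * ψ z) 0 r = 0) : ψ = 0 := by
  have hhigh := moment_eq_zero hψ hr hsmall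
  have hlow : ∀ j : ℕ, circleIntegral (fun z => z ^ ((lam : ℤ) - 1 - j) * ψ z) 0 r = 0 := by
    refine frobenius_recursion_eq_zero
      (u := fun j : ℕ => circleIntegral (fun z => z ^ ((lam : ℤ) - 1 - j) * ψ z) 0 r)
      (lam := lam) (b := b) (c := c) ?_ (fun j => ?_) hc ?_
    · have hrec := moment_recursion hψ hr (lam : ℤ)
      have h0 := hhigh 0
      rw [Nat.cast_zero, add_zero] at h0
      rw [h0, mul_zero, add_zero, show (lam : ℤ) - 2 = lam - 1 - (1 : ℕ) by push_cast; ring,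
        show circleIntegral (fun z => z ^ ((lam : ℤ) - 1) * ψ z) 0 r =
          circleIntegral (fun z => z ^ ((lam : ℤ) - 1 - (0 : ℕ)) * ψ z) 0 r by simp] at hrec
      rw [← hrec]
      push_cast
      ring
    · have hrec := moment_recursion hψ hr ((lam : ℤ) - 1 - j)
      rw [show (lam : ℤ) - 1 - j - 2 = lam - 1 - (j + 2 : ℕ) by push_cast; ring,
        show (lam : ℤ) - 1 - j - 1 = lam - 1 - (j + 1 : ℕ) by push_cast; ring] at hrec
      rw [← hrec]
      push_cast
      ring
    · rw [show (lam : ℤ) - 1 - (2 * lam + 1 : ℕ) = -lam - 2 by push_cast; ring]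
      exact h
  have hall : ∀ n : ℤ, circleIntegral (fun z => z ^ n * ψ z) 0 r = 0 := by
    intro n
    rcases le_or_gt (lam : ℤ) n with hn | hn
    · obtain ⟨k, rfl⟩ := Int.le.dest hn
      exact hhigh k
    · obtain ⟨k, hk⟩ := Int.le.dest (Int.le_sub_one_of_lt hn)
      rw [show n = lam - 1 - k by omega]
      exact hlow k
  have hcont : ContinuousOn ψ (Metric.sphere 0 r) := fun z hz =>
    (hψ.2.1 z (Metric.ne_of_mem_sphere hz hr.ne')).continuousAt.continuousWithinAt
  funext t
  by_cases ht : t = 0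
  · rw [ht]; exact hψ.1
  · exact eq_zero_of_eq_zero_on_circle hr hψ.2.1
      (eq_zero_on_circle_of_moments_eq_zero hr hcont hall) ht

/-- The solution set as a subspace. -/
def slTwoIrregOperSolutionSubmodule (lam : ℕ) (b c : ℂ) : Submodule ℂ (ℂ → ℂ) where
  carrier := slTwoIrregOperSolutionSet lam b c
  zero_mem' := by
    have h : deriv (0 : ℂ → ℂ) = 0 := by funext t; simp
    refine ⟨rfl, fun t _ => differentiableAt_const 0, fun t _ => ?_, fun t _ => ?_⟩
    · rw [h]; exact differentiableAt_const 0
    · rw [h, h]; simp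
  add_mem' := by
    rintro φ ψ ⟨h0, hd, hd', ho⟩ ⟨k0, kd, kd', ko⟩
    have hderiv : ∀ t : ℂ, t ≠ 0 → deriv (φ + ψ) =ᶠ[nhds t] deriv φ + deriv ψ := fun t ht =>
      (isOpen_ne.eventually_mem ht).mono fun s hs => deriv_add (hd s hs) (kd s hs)
    refine ⟨by simp [h0, k0], fun t ht => (hd t ht).add (kd t ht), fun t ht => ?_, fun t ht => ?_⟩
    · exact ((hd' t ht).add (kd' t ht)).congr_of_eventuallyEq (hderiv t ht)
    · rw [(hderiv t ht).deriv_eq, deriv_add (hd' t ht) (kd' t ht), ho t ht, ko t ht, Pi.add_apply]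
      ring
  smul_mem' := by
    rintro a ψ ⟨h0, hd, hd', ho⟩
    have hderiv : ∀ t : ℂ, t ≠ 0 → deriv (a • ψ) =ᶠ[nhds t] a • deriv ψ := fun t ht =>
      (isOpen_ne.eventually_mem ht).mono fun s hs => deriv_const_smul a (hd s hs)
    refine ⟨by simp [h0], fun t ht => (hd t ht).const_smul a, fun t ht => ?_, fun t ht => ?_⟩
    · exact ((hd' t ht).const_smul a).congr_of_eventuallyEq (hderiv t ht)
    · rw [(hderiv t ht).deriv_eq, deriv_const_smul a (hd' t ht), ho t ht, Pi.smul_apply,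
        smul_eq_mul, smul_eq_mul]
      ring

/-- A Laurent moment as a linear functional on the solution space. -/
noncomputable def solutionMoment (lam : ℕ) (b c : ℂ) {r : ℝ} (hr : 0 < r) (n : ℤ) :
    slTwoIrregOperSolutionSubmodule lam b c →ₗ[ℂ] ℂ where
  toFun ψ := circleIntegral (fun z => z ^ n * (ψ : ℂ → ℂ) z) 0 r
  map_add' φ ψ := by
    rw [← circleIntegral.integral_add (circleIntegrable_zpow_mul φ.2.2.1 hr n)
      (circleIntegrable_zpow_mul ψ.2.2.1 hr n)]
    simp [mul_add]
  map_smul' a ψ := by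
    rw [RingHom.id_apply, ← circleIntegral.integral_smul]
    simp [mul_left_comm]

theorem finrank_solutions_le_one {lam : ℕ} {b c : ℂ}
    (hc : (frobeniusPoly lam b (2 * lam + 1)).eval c ≠ 0) :
    Module.finrank ℂ (slTwoIrregOperSolutionSubmodule lam b c) ≤ 1 := by
  obtain ⟨r, hr, hsmall⟩ : ∃ r : ℝ, 0 < r ∧ ‖c‖ * r + ‖b‖ * r ^ 2 ≤ 1 / 2 := by
    have hlim : Filter.Tendsto (fun r : ℝ => ‖c‖ * r + ‖b‖ * r ^ 2) (nhdsWithin 0 (Set.Ioi 0))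
        (nhds 0) := by
      refine Filter.Tendsto.mono_left ?_ nhdsWithin_le_nhds
      have : Continuous fun r : ℝ => ‖c‖ * r + ‖b‖ * r ^ 2 := by fun_prop
      simpa using this.tendsto 0
    exact (eventually_mem_nhdsWithin.and
      (hlim.eventually_le_const (by norm_num : (0 : ℝ) < 1 / 2))).exists
  have hinj : Function.Injective (solutionMoment lam b c hr (-(lam : ℤ) - 2)) := by
    rw [injective_iff_map_eq_zero]
    exact fun ψ h => Subtype.ext (solution_eq_zero ψ.2 hr hsmall hc h)
  simpa using LinearMap.finrank_le_finrank_of_injective hinj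

/-- For `λ ∈ ℕ` and `b ∈ ℂ ∖ {0}`, the set of `c ∈ ℂ` for which the space of holomorphic
solutions on `ℂ ∖ {0}` of `ψ'' = (λ(λ+1)t⁻² + c·t⁻¹ + b)ψ` has dimension 2 is finite. -/
theorem finite_monodromy_free_parameters (lam : ℕ) (b : ℂ) (hb : b ≠ 0) :
    {c : ℂ |
      Module.finrank ℂ ↥(Submodule.span ℂ (slTwoIrregOperSolutionSet lam b c)) = 2}.Finite := by
  refine ((frobeniusPoly lam b (2 * lam + 1)).rootSet_finite ℂ).subset fun c hc => ?_
  rw [Polynomial.mem_rootSet]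
  refine ⟨frobeniusPoly_ne_zero _ _ _, ?_⟩
  rw [Polynomial.coe_aeval_eq_eval]
  by_contra hne
  have hspan : Submodule.span ℂ (slTwoIrregOperSolutionSet lam b c) =
      slTwoIrregOperSolutionSubmodule lam b c :=
    Submodule.span_eq (slTwoIrregOperSolutionSubmodule lam b c)
  have hle := finrank_solutions_le_one hne
  rw [Set.mem_ofPred_eq, hspan] at hc
  omega
end
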